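/- Fix nonnegative integers k₁,k₂,k₃,k₄ and m₁,m₂,m₃,m₄ with k₁+k₂+k₃+k₄ = m₁+m₂+m₃+m₄ (this is exactly the condition that the family below has genus 1). Assume it is not the case that for exactly one index i one has kᵢ = mᵢ = 1 while k_j = m_j = 0 for all j ≠ i (i.e. the family is not of the exceptional type [1,3,2^*][2^*][2^*][2^*]). Then there exists N such that for every n ≥ N for which n − kᵢ − 3mᵢ is nonnegative and even for all i = 1,…,4, the genus-1 ramification data (E₁,…,E₄) of degree n, where Eᵢ consists of kᵢ copies of 1, mᵢ copies of 3, and (n − kᵢ − 3mᵢ)/2 copies of 2, is realizable. -/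

import Mathlib

/-- The full cycle type of a permutation of a finite set: the multiset of the lengths of its
cycles, where each fixed point counts as a cycle of length 1. -/
def fullCycleType {α : Type*} [Fintype α] [DecidableEq α] (σ : Equiv.Perm α) : Multiset ℕ :=
  σ.cycleType + Multiset.replicate (Fintype.card α - σ.cycleType.sum) 1

/-- The subgroup generated by a set of permutations acts transitively. -/
def IsTransitiveSet {α : Type*} (s : Set (Equiv.Perm α)) : Prop :=
  ∀ x y : α, ∃ g ∈ Subgroup.closure s, g x = y

/-- A ramification data, given as a list of multisets of positive integers (partitions of `n`),
is realizable if there are permutations of `{1,…,n}` with product 1, generating a transitive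
subgroup, whose full cycle types are the given multisets. -/
def Realizable (n : ℕ) (E : List (Multiset ℕ)) : Prop :=
  ∃ σ : List (Equiv.Perm (Fin n)),
    σ.map fullCycleType = E ∧ σ.prod = 1 ∧ IsTransitiveSet {g | g ∈ σ}

open Equiv Finset

/-- An annular datum of degree `n`: a tuple of permutations of `n + 1` points with product `1` and a
single orbit, together with points `p ≠ q` such that the first two permutations fix `q` and the last
two fix `p`. Identifying `p` with `q` yields a tuple of degree `n` in which the `i`-th permutation
has `k i` fixed points, `m i` three-cycles, and otherwise only two-cycles. -/
def Annular (k m : Fin 4 → ℕ) (n : ℕ) : Prop :=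
  ∃ (A : Type) (_ : Fintype A) (_ : DecidableEq A) (s : Fin 4 → Perm A) (p q : A) (b : Fin 4 → ℕ),
    Fintype.card A = n + 1 ∧ p ≠ q ∧ s 0 q = q ∧ s 1 q = q ∧ s 2 p = p ∧ s 3 p = p ∧
    s 0 * s 1 * s 2 * s 3 = 1 ∧
    (∀ i, (s i).cycleType = Multiset.replicate (m i) 3 + Multiset.replicate (b i) 2 ∧
      k i + 3 * m i + 2 * b i = n) ∧
    ∀ T : Set A, (∀ i x, s i x ∈ T ↔ x ∈ T) → ∀ x y, x ∈ T → y ∈ T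

section CycleType

variable {A : Type*} [Fintype A] [DecidableEq A]

theorem Equiv.Perm.card_three_points (σ : Perm A) :
    #{x | σ x ≠ x ∧ σ (σ (σ x)) = x} = 3 * σ.cycleType.count 3 := by
  induction σ using Perm.cycle_induction_on with
  | base_one => simp
  | base_cycles σ hσ =>
    have key : ∀ x, σ x ≠ x → (σ (σ (σ x)) = x ↔ orderOf σ = 3) := by
      intro x hx
      have h3 : σ (σ (σ x)) = (σ ^ 3) x := by simp [pow_succ]
      rw [h3]
      constructor
      · intro h
        have h1 : σ ^ 3 = 1 := hσ.pow_eq_one_iff.2 ⟨x, hx, h⟩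
        exact orderOf_eq_prime h1 hσ.ne_one
      · intro h
        rw [← h, pow_orderOf_eq_one]
        rfl
    rw [hσ.cycleType, Multiset.count_singleton, ← hσ.orderOf]
    split_ifs with h
    · have : (univ.filter fun x => σ x ≠ x ∧ σ (σ (σ x)) = x) = σ.support := by
        ext x
        simp only [mem_filter, mem_univ, true_and, Perm.mem_support]
        exact ⟨fun hx => hx.1, fun hx => ⟨hx, (key x hx).2 h.symm⟩⟩
      rw [this, ← hσ.orderOf, ← h]
    · simp only [mul_zero, card_eq_zero, filter_eq_empty_iff, mem_univ, forall_const]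
      rintro x ⟨hx, h3⟩
      exact h ((key x hx).1 h3).symm
  | induction_disjoint σ τ hd _ hσ hτ =>
    rw [hd.cycleType_mul, Multiset.count_add, mul_add, ← hσ, ← hτ, ← card_union_of_disjoint]
    · congr 1
      ext x
      have hc : ∀ y, σ (τ y) = τ (σ y) := fun y => by
        rw [← Perm.mul_apply, hd.commute.eq, Perm.mul_apply]
      simp only [mem_filter, mem_univ, true_and, mem_union, Perm.mul_apply]
      rcases hd x with h | h
      · simp [hc, h]
      · simp [← hc, h]
    · rw [Finset.disjoint_left]
      intro x
      simp only [mem_filter, mem_univ, true_and]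
      rcases hd x with h | h <;> simp [h]

theorem Equiv.Perm.mem_cycleType_of_forall {σ : Perm A}
    (h : ∀ x, σ (σ x) = x ∨ σ (σ (σ x)) = x) {n : ℕ} (hn : n ∈ σ.cycleType) : n = 2 ∨ n = 3 := by
  obtain ⟨c, τ, rfl, hd, hc, rfl⟩ := Perm.mem_cycleType_iff.1 hn
  obtain ⟨x, hx⟩ := hc.nonempty_support
  rw [Perm.mem_support] at hx
  have hτ : ∀ y, c y ≠ y → (c * τ) y = c y := fun y hy => by
    rw [Perm.mul_apply, (hd y).resolve_left hy]
  have h1 : c (c x) ≠ c x := fun h => hx (c.injective h)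
  have h2 : c (c (c x)) ≠ c (c x) := fun h => h1 (c.injective h)
  have := h x
  rw [hτ x hx, hτ _ h1, hτ _ h2] at this
  rw [← hc.orderOf]
  rcases this with h | h
  · exact .inl <| orderOf_eq_prime (hc.pow_eq_one_iff.2 ⟨x, hx, by simpa [pow_succ] using h⟩)
      hc.ne_one
  · exact .inr <| orderOf_eq_prime (hc.pow_eq_one_iff.2 ⟨x, hx, by simpa [pow_succ] using h⟩)
      hc.ne_one

theorem Equiv.Perm.cycleType_of_forall {σ : Perm A} (h : ∀ x, σ (σ x) = x ∨ σ (σ (σ x)) = x) :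
    σ.cycleType = Multiset.replicate (σ.cycleType.count 3) 3 +
      Multiset.replicate (σ.cycleType.count 2) 2 := by
  ext n
  rw [Multiset.count_add, Multiset.count_replicate, Multiset.count_replicate]
  by_cases hn : n ∈ σ.cycleType
  · rcases Perm.mem_cycleType_of_forall h hn with rfl | rfl <;> simp
  · rw [Multiset.count_eq_zero_of_notMem hn]
    split_ifs with h3 h2 h2
    · omega
    · simp [h3, hn]
    · simp [h2, hn]
    · rfl

theorem Equiv.Perm.cycleType_viaEmbedding {B : Type*} [Fintype B] [DecidableEq B] (σ : Perm A)
    (e : A ↪ B) : (σ.viaEmbedding e).cycleType = σ.cycleType := by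
  rw [Perm.viaEmbedding]
  convert Perm.cycleType_extendDomain (Equiv.ofInjective e.1 e.2)

/-- Permutations with a common fixed point restrict to its complement. -/
theorem Equiv.Perm.exists_restrict {s : Fin 4 → Perm A} {z : A} (hz : ∀ i, s i z = z)
    (hprod : s 0 * s 1 * s 2 * s 3 = 1) :
    ∃ t : Fin 4 → Perm {x // x ≠ z}, (∀ i x, (t i x : A) = s i x) ∧ t 0 * t 1 * t 2 * t 3 = 1 ∧
      ∀ i, (t i).cycleType = (s i).cycleType := by
  have hp : ∀ i x, s i x ≠ z ↔ x ≠ z := fun i x => by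
    conv_lhs => rw [← hz i]
    exact (s i).injective.ne_iff
  refine ⟨fun i => (s i).subtypePerm (hp i), fun i x => rfl, ?_, fun i => ?_⟩
  · ext x
    exact Perm.congr_fun hprod x
  · rw [← Perm.cycleType_ofSubtype, Perm.ofSubtype_subtypePerm]
    rintro x hx rfl
    exact hx (hz i)

end CycleType

namespace Annular

variable {k m k' m' : Fin 4 → ℕ} {n n' : ℕ}

theorem swap_zero_one (h : Annular k m n) :
    Annular (k ∘ swap 0 1) (m ∘ swap 0 1) n := by
  obtain ⟨A, _, _, s, p, q, b, hA, hpq, h0, h1, h2, h3, hprod, hs, hT⟩ := h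
  refine ⟨A, ‹_›, ‹_›, ![s 1, (s 1)⁻¹ * s 0 * s 1, s 2, s 3], p, q, b ∘ swap 0 1, hA, hpq, h1, ?_,
    h2, h3, ?_, ?_, fun T hTs => hT T ?_⟩
  · simp [h0, h1, Equiv.symm_apply_eq]
  · simpa [mul_assoc] using hprod
  · have hconj : ((s 1)⁻¹ * s 0 * s 1).cycleType = (s 0).cycleType := by
      simpa using Perm.cycleType_conj (σ := s 0) (τ := (s 1)⁻¹)
    have e2 : swap (0 : Fin 4) 1 2 = 2 := by decide
    have e3 : swap (0 : Fin 4) 1 3 = 3 := by decide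
    intro i
    fin_cases i
    · simpa using hs 1
    · simpa [hconj] using hs 0
    · simpa [e2] using hs 2
    · simpa [e3] using hs 3
  · have t1 : ∀ x, s 1 x ∈ T ↔ x ∈ T := hTs 0
    have t0 : ∀ x, s 0 x ∈ T ↔ x ∈ T := fun x => by
      have := hTs 1 ((s 1)⁻¹ x)
      simp only [Matrix.cons_val_one, Matrix.cons_val_zero, Perm.mul_apply,
        Perm.coe_inv, apply_symm_apply] at this
      rw [← t1, apply_symm_apply, ← t1 ((s 1).symm x), apply_symm_apply] at this
      exact this
    intro i
    fin_cases i
    exacts [t0, t1, hTs 2, hTs 3]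

theorem swap_pairs (h : Annular k m n) : Annular (k ∘ (· + 2)) (m ∘ (· + 2)) n := by
  obtain ⟨A, _, _, s, p, q, b, hA, hpq, h0, h1, h2, h3, hprod, hs, hT⟩ := h
  refine ⟨A, ‹_›, ‹_›, s ∘ (· + 2), q, p, b ∘ (· + 2), hA, hpq.symm, h2, h3, h0, h1, ?_,
    ?_, fun T hTs => hT T fun i => ?_⟩
  · have : s 2 * s 3 = (s 0 * s 1)⁻¹ := by
      rw [eq_inv_iff_mul_eq_one, mul_eq_one_comm]
      simpa [mul_assoc] using hprod
    change s 2 * s 3 * s 0 * s 1 = 1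
    rw [this, mul_assoc, inv_mul_cancel]
  · exact fun i => hs (i + 2)
  · have e : i + 2 + 2 = i := by fin_cases i <;> rfl
    have := hTs (i + 2)
    simpa only [Function.comp_apply, e] using this

theorem add (h : Annular k m n) (h' : Annular k' m' n') : Annular (k + k') (m + m') (n + n') := by
  obtain ⟨A, _, _, s, p, q, b, hA, hpq, h0, h1, h2, h3, hprod, hs, hT⟩ := h
  obtain ⟨B, _, _, t, p', q', b', hB, hpq', h0', h1', h2', h3', hprod', ht, hT'⟩ := h'
  let f : A ↪ A ⊕ {x // x ≠ p'} := ⟨Sum.inl, Sum.inl_injective⟩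
  let g : B ↪ A ⊕ {x // x ≠ p'} :=
    ⟨fun x => if hx : x = p' then Sum.inl q else Sum.inr ⟨x, hx⟩, fun x y hxy => by
      by_cases hx : x = p' <;> by_cases hy : y = p' <;> simp_all⟩
  have gp : g p' = f q := dif_pos rfl
  have gx : ∀ x (hx : x ≠ p'), g x = Sum.inr ⟨x, hx⟩ := fun x hx => dif_neg hx
  have fg : ∀ a, a ≠ q → f a ∉ Set.range g := by
    rintro a ha ⟨x, hx⟩
    by_cases hxp : x = p'
    · rw [hxp, gp] at hx
      exact ha (f.injective hx).symm
    · rw [gx x hxp] at hx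
      cases hx
  have gf : ∀ x, x ≠ p' → g x ∉ Set.range f := by
    rintro x hx ⟨a, ha⟩
    rw [gx x hx] at ha
    cases ha
  have cover : ∀ z, (∃ a, f a = z) ∨ ∃ x, x ≠ p' ∧ g x = z := by
    rintro (a | ⟨x, hx⟩)
    · exact .inl ⟨a, rfl⟩
    · exact .inr ⟨x, hx, gx x hx⟩
  let F := Perm.viaEmbeddingHom f
  let G := Perm.viaEmbeddingHom g
  have Ff : ∀ σ a, F σ (f a) = f (σ a) := fun σ a => Perm.viaEmbedding_apply ..
  have Fg : ∀ σ x, x ≠ p' → F σ (g x) = g x := fun σ x hx =>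
    Perm.viaEmbedding_apply_of_notMem _ _ _ (gf x hx)
  have Gg : ∀ σ x, G σ (g x) = g (σ x) := fun σ x => Perm.viaEmbedding_apply ..
  have Gf : ∀ σ a, a ≠ q → G σ (f a) = f a := fun σ a ha =>
    Perm.viaEmbedding_apply_of_notMem _ _ _ (fg a ha)
  have disj : ∀ σ τ, σ q = q ∨ τ p' = p' → Perm.Disjoint (F σ) (G τ) := by
    intro σ τ hστ z
    rcases cover z with ⟨a, rfl⟩ | ⟨x, hx, rfl⟩
    · by_cases ha : a = q
      · subst ha
        exact hστ.imp (fun h => by rw [Ff, h]) fun h => by rw [← gp, Gg, h]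
      · exact .inr (Gf τ a ha)
    · exact .inl (Fg σ x hx)
  have hfix : ∀ i, s i q = q ∨ t i p' = p' := by
    intro i
    fin_cases i
    exacts [.inl h0, .inl h1, .inr h2', .inr h3']
  have hgp : g q' ≠ f p := by
    rw [gx q' hpq'.symm]
    simp [f]
  refine ⟨_, inferInstance, inferInstance, fun i => F (s i) * G (t i), f p, g q', b + b', ?_,
    hgp.symm, ?_, ?_, ?_, ?_, ?_, fun i => ⟨?_, ?_⟩, fun T hTs => ?_⟩
  · rw [Fintype.card_sum, Fintype.card_subtype_compl, Fintype.card_subtype_eq]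
    omega
  · rw [Perm.mul_apply, Gg, h0', Fg _ _ hpq'.symm]
  · rw [Perm.mul_apply, Gg, h1', Fg _ _ hpq'.symm]
  · rw [Perm.mul_apply, Gf _ _ hpq, Ff, h2]
  · rw [Perm.mul_apply, Gf _ _ hpq, Ff, h3]
  · have c1 : F (s 1) * G (t 0) = G (t 0) * F (s 1) := (disj _ _ (.inl h1)).commute.eq
    have c2 : F (s 2) * G (t 2) = G (t 2) * F (s 2) := (disj _ _ (.inr h2')).commute.eq
    have c3 : F (s 2 * s 3) * G (t 3) = G (t 3) * F (s 2 * s 3) :=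
      (disj _ _ (.inr h3')).commute.eq
    calc F (s 0) * G (t 0) * (F (s 1) * G (t 1)) * (F (s 2) * G (t 2)) * (F (s 3) * G (t 3))
        = F (s 0) * (G (t 0) * F (s 1)) * G (t 1) * (F (s 2) * G (t 2)) * (F (s 3) * G (t 3)) := by
          simp only [mul_assoc]
      _ = F (s 0) * F (s 1) * (G (t 0) * G (t 1) * G (t 2)) * (F (s 2 * s 3) * G (t 3)) := by
          rw [← c1, c2, map_mul]
          simp only [mul_assoc]
      _ = F (s 0) * F (s 1) * G (t 0 * t 1 * t 2 * t 3) * F (s 2 * s 3) := by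
          rw [c3]
          simp only [map_mul, mul_assoc]
      _ = F (s 0 * s 1 * s 2 * s 3) := by
          rw [hprod', map_one, mul_one]
          simp only [map_mul, mul_assoc]
      _ = 1 := by rw [hprod, map_one]
  · rw [(disj _ _ (hfix i)).cycleType_mul]
    change (Perm.viaEmbedding _ _).cycleType + (Perm.viaEmbedding _ _).cycleType = _
    rw [Perm.cycleType_viaEmbedding, Perm.cycleType_viaEmbedding, (hs i).1, (ht i).1]
    simp only [Pi.add_apply, Multiset.replicate_add]
    abel
  · have := (hs i).2
    have := (ht i).2
    simp only [Pi.add_apply]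
    omega
  · have hF : ∀ a a', f a ∈ T → f a' ∈ T := by
      refine hT (f ⁻¹' T) fun i a => ?_
      by_cases ha : s i a = a
      · rw [ha]
      by_cases haq : a = q
      · subst haq
        have := hTs i (f a)
        rwa [Perm.mul_apply, ← gp, Gg, (hfix i).resolve_left ha, gp, Ff] at this
      · have := hTs i (f a)
        rwa [Perm.mul_apply, Gf _ _ haq, Ff] at this
    have hG : ∀ x x', g x ∈ T → g x' ∈ T := by
      refine hT' (g ⁻¹' T) fun i x => ?_
      have := hTs i (g x)
      rw [Perm.mul_apply, Gg] at this
      by_cases hx : t i x = p'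
      · by_cases hxp : t i p' = p'
        · rw [(t i).injective (hx.trans hxp.symm)]
          exact Set.mem_preimage.trans (by rw [hxp]; rfl)
        · rw [hx, gp, Ff, (hfix i).resolve_right hxp, ← gp] at this
          rwa [Set.mem_preimage, hx]
      · rwa [Fg _ _ hx] at this
    have key : ∀ z, z ∈ T ↔ f q ∈ T := by
      intro z
      rcases cover z with ⟨a, rfl⟩ | ⟨x, -, rfl⟩
      · exact ⟨hF _ _, hF _ _⟩
      · rw [← gp]
        exact ⟨hG _ _, hG _ _⟩
    exact fun x y hx => (key y).2 ((key x).1 hx)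

end Annular

theorem annular_realizable {k m : Fin 4 → ℕ} {n : ℕ} (h : Annular k m n) :
    Realizable n (List.ofFn fun i =>
        Multiset.replicate (k i) 1 + Multiset.replicate (m i) 3 +
          Multiset.replicate ((n - (k i + 3 * m i)) / 2) 2) := by
  obtain ⟨A, _, _, s, p, q, b, hA, hpq, h0, h1, h2, h3, hprod, hs, hT⟩ := h
  set w : Perm A := swap p q with hw
  have hww : w * w = 1 := swap_mul_self p q
  let s' : Fin 4 → Perm A := ![s 0, s 1, w * s 2 * w, w * s 3 * w]
  have hfix : ∀ i, s' i q = q := by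
    intro i
    fin_cases i
    · exact h0
    · exact h1
    · simp [s', hw, h2]
    · simp [s', hw, h3]
  have hprod' : s' 0 * s' 1 * s' 2 * s' 3 = 1 := by
    have hu : s 0 * s 1 * (s 2 * s 3) = 1 := by rw [← hprod]; simp only [mul_assoc]
    have huq : (s 0 * s 1) q = q := by rw [Perm.mul_apply, h1, h0]
    have hup : (s 0 * s 1) p = p := by
      have := Perm.congr_fun hu p
      rwa [Perm.mul_apply, Perm.mul_apply (s 2), h3, h2] at this
    have huw : s 0 * s 1 * w = w * (s 0 * s 1) := by
      rw [hw, Equiv.mul_swap_eq_swap_mul, hup, huq]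
    calc s 0 * s 1 * (w * s 2 * w) * (w * s 3 * w)
        = s 0 * s 1 * w * s 2 * (w * w) * s 3 * w := by simp only [mul_assoc]
      _ = w * (s 0 * s 1 * (s 2 * s 3)) * w := by
        rw [hww, huw]
        simp only [mul_assoc, one_mul]
      _ = 1 := by rw [hu, mul_one, hww]
  have hct : ∀ i, (s' i).cycleType = (s i).cycleType := by
    have hconj : ∀ σ : Perm A, (w * σ * w).cycleType = σ.cycleType := fun σ => by
      have : w⁻¹ = w := swap_inv p q
      conv_lhs => rw [← this, this, ← this]
      simpa [this] using Perm.cycleType_conj (σ := σ) (τ := w)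
    intro i
    fin_cases i
    exacts [rfl, rfl, hconj _, hconj _]
  obtain ⟨t, hts, htprod, htc⟩ := Perm.exists_restrict hfix hprod'
  have hcard : Fintype.card {x // x ≠ q} = Fintype.card (Fin n) := by
    rw [Fintype.card_subtype_compl, Fintype.card_subtype_eq, Fintype.card_fin, hA]
    rfl
  let e : {x // x ≠ q} ≃ Fin n := Fintype.equivOfCardEq hcard
  let E := Perm.viaEmbeddingHom e.toEmbedding
  have hE : ∀ σ x, E σ (e x) = e (σ x) := fun σ x =>
    Perm.viaEmbedding_apply σ e.toEmbedding x
  refine ⟨List.ofFn fun i => E (t i), ?_, ?_, ?_⟩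
  · rw [List.map_ofFn]
    congr 1
    funext i
    have hc : (E (t i)).cycleType = (s i).cycleType := by
      rw [← hct, ← htc]
      exact Perm.cycleType_viaEmbedding _ _
    obtain ⟨hi, hn⟩ := hs i
    have hb : (n - (k i + 3 * m i)) / 2 = b i := by omega
    have hk : n - (m i * 3 + b i * 2) = k i := by omega
    simp only [Function.comp_apply, fullCycleType, hc, hi, hb, Fintype.card_fin, Multiset.sum_add,
      Multiset.sum_replicate, smul_eq_mul, hk]
    abel
  · have : E (t 0 * t 1 * t 2 * t 3) = 1 := by rw [htprod, map_one]
    simpa [List.ofFn_succ, mul_assoc] using this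
  · set H := Subgroup.closure {g | g ∈ List.ofFn fun i => E (t i)} with hH
    have hmem : ∀ i, E (t i) ∈ H := fun i =>
      Subgroup.subset_closure (List.mem_ofFn.2 ⟨i, rfl⟩)
    let φ : A → {x // x ≠ q} := fun a => if ha : a = q then ⟨p, hpq⟩ else ⟨a, ha⟩
    have φq : ∀ a, a ≠ q → (φ a : A) = a := fun a ha => by simp [φ, ha]
    have φp : ∀ a, a ≠ p → (φ a : A) = w a := fun a ha => by
      by_cases haq : a = q
      · subst haq
        simp [φ, hw]
      · rw [φq a haq, hw, swap_apply_of_ne_of_ne ha haq]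
    have hlow : ∀ i a, s i q = q → s' i = s i → φ (s i a) = φ a ∨ φ (s i a) = t i (φ a) := by
      intro i a hi hi'
      by_cases ha : a = q
      · exact .inl (by rw [ha, hi])
      · refine .inr (Subtype.ext ?_)
        rw [hts, hi', φq a ha, φq]
        exact fun h => ha ((s i).injective (h.trans hi.symm))
    have hhigh : ∀ i a, s i p = p → s' i = w * s i * w →
        φ (s i a) = φ a ∨ φ (s i a) = t i (φ a) := by
      intro i a hi hi'
      by_cases ha : a = p
      · exact .inl (by rw [ha, hi])
      · refine .inr (Subtype.ext ?_)
        have hwa : w (w a) = a := Perm.congr_fun hww a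
        rw [hts, hi', φp a ha, φp, Perm.mul_apply, Perm.mul_apply, hwa]
        exact fun h => ha ((s i).injective (h.trans hi.symm))
    have hφ : ∀ i a, φ (s i a) = φ a ∨ φ (s i a) = t i (φ a) := by
      intro i a
      fin_cases i
      exacts [hlow 0 a h0 rfl, hlow 1 a h1 rfl, hhigh 2 a h2 rfl, hhigh 3 a h3 rfl]
    intro x y
    obtain ⟨x, rfl⟩ := e.surjective x
    obtain ⟨y, rfl⟩ := e.surjective y
    have hφx : ∀ z : {x // x ≠ q}, φ z = z := fun z => Subtype.ext (φq z z.2)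
    have := hT {a | ∃ g ∈ H, g (e x) = e (φ a)} ?_ x y ⟨1, H.one_mem, by rw [hφx]; rfl⟩
    · rw [Set.mem_ofPred_eq, hφx] at this
      exact this
    · intro i a
      simp only [Set.mem_ofPred_eq]
      rcases hφ i a with h | h
      · rw [h]
      · rw [h, ← hE]
        constructor
        · rintro ⟨g, hg, hgx⟩
          refine ⟨(E (t i))⁻¹ * g, H.mul_mem (H.inv_mem (hmem i)) hg, ?_⟩
          rw [Perm.mul_apply, hgx, Perm.inv_eq_iff_eq]
        · rintro ⟨g, hg, hgx⟩
          exact ⟨E (t i) * g, H.mul_mem (hmem i) hg, by rw [Perm.mul_apply, hgx]⟩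

/-- Explicit maps on `Fin (deg + 1)` describing an annular datum with distinguished points `0` and
`q`. -/
structure AnnularTable where
  deg : ℕ
  ones : Fin 4 → ℕ
  threes : Fin 4 → ℕ
  q : Fin (deg + 1)
  act : Fin 4 → Fin (deg + 1) → Fin (deg + 1)

namespace AnnularTable

/-- The conditions, checkable by evaluation, under which a table defines an annular datum. -/
def Valid (t : AnnularTable) : Prop :=
  0 ≠ t.q ∧ t.act 0 t.q = t.q ∧ t.act 1 t.q = t.q ∧ t.act 2 0 = 0 ∧ t.act 3 0 = 0 ∧
    (∀ x, t.act 0 (t.act 1 (t.act 2 (t.act 3 x))) = x) ∧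
    (∀ i x, t.act i (t.act i x) = x ∨ t.act i (t.act i (t.act i x)) = x) ∧
    (∀ i, #{x | t.act i x ≠ x ∧ t.act i (t.act i (t.act i x)) = x} = 3 * t.threes i) ∧
    (∀ i, #{x | t.act i x ≠ x} + t.ones i = t.deg) ∧
    ∀ x, x ≠ 0 → ∃ y < x, ∃ i, t.act i y = x

instance : DecidablePred Valid := fun t => by unfold Valid; infer_instance

theorem Valid.annular {t : AnnularTable} (h : t.Valid) : Annular t.ones t.threes t.deg := by
  obtain ⟨hq, h0, h1, h2, h3, hprod, hcyc, hthree, hone, hconn⟩ := h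
  have hinj : ∀ i, Function.Injective (t.act i) := by
    intro i
    have h6 : ∀ x, (t.act i)^[6] x = x := by
      intro x
      rcases hcyc i x with h | h <;> simp [h]
    exact Function.LeftInverse.injective (g := (t.act i)^[5]) h6
  let s : Fin 4 → Perm (Fin (t.deg + 1)) := fun i =>
    Equiv.ofBijective (t.act i) (Finite.injective_iff_bijective.1 (hinj i))
  refine ⟨_, inferInstance, inferInstance, s, 0, t.q, fun i => (s i).cycleType.count 2,
    Fintype.card_fin _, hq, h0, h1, h2, h3, Equiv.ext hprod, fun i => ?_, fun T hT => ?_⟩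
  · have hc := Perm.cycleType_of_forall (σ := s i) (hcyc i)
    have h3 : (s i).cycleType.count 3 = t.threes i :=
      Nat.eq_of_mul_eq_mul_left three_pos ((s i).card_three_points.symm.trans (hthree i))
    rw [h3] at hc
    refine ⟨hc, ?_⟩
    have hsum := (s i).sum_cycleType
    rw [hc] at hsum
    simp only [Multiset.sum_add, Multiset.sum_replicate, smul_eq_mul] at hsum
    have hsupp : #(s i).support + t.ones i = t.deg := hone i
    dsimp only
    omega
  · have h0T : ∀ x, x ∈ T ↔ 0 ∈ T := by
      intro x
      induction x using WellFoundedLT.induction with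
      | ind x ih =>
        by_cases hx : x = 0
        · rw [hx]
        · obtain ⟨y, hy, i, rfl⟩ := hconn x hx
          rw [← ih y hy]
          exact hT i y
    exact fun x y hx => (h0T y).2 ((h0T x).1 hx)

end AnnularTable

/-- A representative, up to the symmetries of the cyclic order of the four branch points, of each
element that is needed to generate all non-exceptional families. -/
def annularTables : List AnnularTable :=
 [⟨2, ![0, 0, 0, 0], ![0, 0, 0, 0], 2,
     ![![1, 0, 2],
       ![1, 0, 2],
       ![0, 2, 1],
       ![0, 2, 1]]⟩,
   ⟨8, ![0, 0, 0, 2], ![0, 0, 0, 2], 7,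
     ![![1, 0, 3, 2, 5, 4, 8, 7, 6],
       ![1, 0, 4, 6, 2, 8, 3, 7, 5],
       ![0, 2, 1, 7, 8, 6, 5, 3, 4],
       ![0, 2, 5, 8, 4, 1, 6, 3, 7]]⟩,
   ⟨14, ![0, 0, 0, 3], ![0, 0, 0, 3], 13,
     ![![1, 0, 3, 2, 5, 4, 7, 6, 9, 8, 11, 10, 14, 13, 12],
       ![1, 0, 4, 6, 2, 8, 3, 10, 5, 12, 7, 14, 9, 13, 11],
       ![0, 2, 1, 7, 8, 6, 5, 3, 4, 10, 9, 12, 11, 14, 13],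
       ![0, 2, 5, 8, 4, 1, 9, 7, 11, 6, 13, 3, 12, 14, 10]]⟩,
   ⟨4, ![0, 0, 1, 1], ![0, 0, 1, 1], 2,
     ![![1, 0, 2, 4, 3],
       ![1, 0, 2, 4, 3],
       ![0, 2, 3, 1, 4],
       ![0, 3, 1, 2, 4]]⟩,
   ⟨4, ![0, 1, 0, 1], ![0, 1, 0, 1], 4,
     ![![1, 0, 3, 2, 4],
       ![1, 2, 0, 3, 4],
       ![0, 3, 4, 1, 2],
       ![0, 4, 1, 3, 2]]⟩,
   ⟨6, ![0, 0, 0, 2], ![0, 0, 2, 0], 6,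
     ![![1, 0, 4, 5, 2, 3, 6],
       ![1, 0, 5, 4, 3, 2, 6],
       ![0, 2, 3, 1, 5, 6, 4],
       ![0, 3, 2, 1, 4, 6, 5]]⟩,
   ⟨6, ![0, 0, 0, 2], ![0, 2, 0, 0], 6,
     ![![1, 0, 3, 2, 5, 4, 6],
       ![1, 2, 0, 4, 5, 3, 6],
       ![0, 2, 1, 5, 6, 3, 4],
       ![0, 1, 3, 2, 6, 5, 4]]⟩,
   ⟨8, ![0, 0, 0, 3], ![0, 0, 2, 1], 8,
     ![![1, 0, 3, 2, 5, 4, 7, 6, 8],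
       ![1, 0, 4, 6, 2, 7, 3, 5, 8],
       ![0, 2, 1, 4, 7, 6, 8, 3, 5],
       ![0, 2, 5, 3, 4, 1, 8, 7, 6]]⟩,
   ⟨8, ![0, 0, 0, 3], ![0, 2, 0, 1], 5,
     ![![1, 0, 3, 2, 6, 5, 4, 8, 7],
       ![1, 2, 0, 6, 7, 5, 8, 4, 3],
       ![0, 3, 4, 1, 2, 8, 7, 6, 5],
       ![0, 4, 5, 3, 1, 8, 6, 7, 2]]⟩,
   ⟨10, ![0, 0, 1, 2], ![0, 0, 3, 0], 10,
     ![![1, 0, 4, 5, 2, 3, 7, 6, 9, 8, 10],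
       ![1, 0, 5, 7, 8, 2, 9, 3, 4, 6, 10],
       ![0, 2, 3, 1, 5, 9, 8, 7, 10, 4, 6],
       ![0, 3, 6, 1, 4, 7, 2, 5, 10, 9, 8]]⟩,
   ⟨6, ![0, 0, 1, 2], ![0, 2, 1, 0], 3,
     ![![1, 0, 4, 3, 2, 6, 5],
       ![1, 2, 0, 3, 5, 6, 4],
       ![0, 3, 1, 2, 6, 5, 4],
       ![0, 3, 4, 1, 2, 5, 6]]⟩,
   ⟨10, ![0, 1, 0, 2], ![0, 3, 0, 0], 10,
     ![![1, 0, 3, 2, 6, 8, 4, 9, 5, 7, 10],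
       ![1, 2, 0, 4, 5, 3, 9, 6, 8, 7, 10],
       ![0, 2, 1, 5, 7, 3, 8, 4, 6, 10, 9],
       ![0, 1, 3, 2, 4, 6, 5, 8, 7, 10, 9]]⟩,
   ⟨6, ![0, 1, 0, 2], ![2, 1, 0, 0], 6,
     ![![1, 2, 0, 4, 5, 3, 6],
       ![2, 3, 0, 5, 4, 1, 6],
       ![0, 2, 1, 6, 5, 4, 3],
       ![0, 1, 4, 6, 2, 5, 3]]⟩,
   ⟨6, ![0, 1, 0, 2], ![0, 1, 2, 0], 6,
     ![![1, 0, 5, 4, 3, 2, 6],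
       ![1, 2, 0, 3, 5, 4, 6],
       ![0, 3, 6, 5, 2, 1, 4],
       ![0, 4, 6, 3, 1, 5, 2]]⟩,
   ⟨3, ![0, 0, 1, 1], ![1, 1, 0, 0], 3,
     ![![1, 2, 0, 3],
       ![2, 0, 1, 3],
       ![0, 1, 3, 2],
       ![0, 1, 3, 2]]⟩,
   ⟨3, ![0, 1, 0, 1], ![1, 0, 1, 0], 3,
     ![![1, 2, 0, 3],
       ![2, 1, 0, 3],
       ![0, 2, 3, 1],
       ![0, 1, 3, 2]]⟩,
   ⟨5, ![0, 0, 0, 3], ![1, 1, 1, 0], 5,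
     ![![1, 0, 3, 4, 2, 5],
       ![1, 2, 0, 4, 3, 5],
       ![0, 2, 3, 1, 5, 4],
       ![0, 1, 2, 3, 5, 4]]⟩,
   ⟨9, ![0, 1, 1, 1], ![3, 0, 0, 0], 9,
     ![![1, 2, 0, 4, 6, 8, 3, 5, 7, 9],
       ![2, 3, 0, 1, 7, 8, 6, 4, 5, 9],
       ![0, 2, 1, 4, 3, 6, 5, 7, 9, 8],
       ![0, 1, 4, 5, 2, 3, 7, 6, 9, 8]]⟩,
   ⟨5, ![0, 0, 1, 2], ![1, 1, 0, 1], 4,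
     ![![1, 0, 3, 5, 4, 2],
       ![1, 2, 0, 5, 4, 3],
       ![0, 2, 1, 4, 3, 5],
       ![0, 1, 4, 2, 3, 5]]⟩,
   ⟨5, ![0, 1, 0, 2], ![1, 0, 1, 1], 2,
     ![![1, 0, 2, 4, 5, 3],
       ![1, 0, 2, 5, 4, 3],
       ![0, 2, 3, 1, 5, 4],
       ![0, 3, 1, 2, 4, 5]]⟩,
   ⟨7, ![0, 1, 1, 1], ![1, 0, 0, 2], 7,
     ![![1, 0, 3, 6, 5, 4, 2, 7],
       ![1, 0, 4, 6, 2, 5, 3, 7],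
       ![0, 2, 1, 5, 7, 3, 6, 4],
       ![0, 2, 5, 7, 3, 1, 6, 4]]⟩,
   ⟨7, ![0, 1, 1, 1], ![1, 2, 0, 0], 7,
     ![![1, 0, 3, 2, 6, 4, 5, 7],
       ![1, 2, 0, 4, 5, 3, 6, 7],
       ![0, 2, 1, 5, 7, 3, 6, 4],
       ![0, 1, 3, 2, 7, 6, 5, 4]]⟩,
   ⟨7, ![0, 0, 0, 4], ![1, 1, 1, 1], 4,
     ![![1, 0, 3, 5, 4, 2, 7, 6],
       ![1, 2, 0, 6, 4, 7, 3, 5],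
       ![0, 2, 3, 1, 7, 6, 5, 4],
       ![0, 1, 4, 3, 7, 5, 6, 2]]⟩,
   ⟨13, ![1, 1, 1, 1], ![0, 0, 0, 4], 8,
     ![![1, 0, 3, 2, 5, 4, 9, 11, 8, 6, 13, 7, 12, 10],
       ![1, 0, 4, 6, 2, 7, 3, 5, 8, 11, 13, 9, 12, 10],
       ![0, 2, 1, 7, 8, 6, 5, 3, 4, 12, 11, 10, 9, 13],
       ![0, 2, 5, 8, 3, 1, 10, 12, 4, 7, 11, 6, 9, 13]]⟩,
   ⟨7, ![0, 0, 1, 3], ![1, 1, 2, 0], 3,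
     ![![1, 0, 4, 3, 2, 6, 7, 5],
       ![1, 2, 0, 3, 5, 4, 7, 6],
       ![0, 3, 1, 2, 5, 6, 4, 7],
       ![0, 3, 4, 1, 2, 5, 6, 7]]⟩,
   ⟨9, ![0, 2, 1, 1], ![3, 1, 0, 0], 9,
     ![![1, 2, 0, 4, 7, 6, 8, 3, 5, 9],
       ![2, 3, 0, 5, 4, 1, 8, 7, 6, 9],
       ![0, 2, 1, 3, 5, 4, 7, 6, 9, 8],
       ![0, 1, 4, 6, 2, 7, 3, 5, 9, 8]]⟩,
   ⟨7, ![0, 1, 0, 3], ![1, 2, 1, 0], 3,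
     ![![1, 0, 4, 3, 2, 6, 7, 5],
       ![1, 2, 0, 3, 5, 6, 4, 7],
       ![0, 3, 1, 2, 6, 7, 4, 5],
       ![0, 3, 4, 1, 2, 5, 6, 7]]⟩,
   ⟨9, ![0, 1, 1, 2], ![3, 0, 0, 1], 6,
     ![![1, 2, 0, 7, 8, 3, 6, 5, 9, 4],
       ![2, 3, 0, 1, 7, 5, 6, 4, 9, 8],
       ![0, 4, 5, 6, 1, 2, 3, 8, 7, 9],
       ![0, 5, 6, 2, 7, 1, 3, 4, 8, 9]]⟩,
   ⟨8, ![0, 0, 1, 2], ![0, 0, 1, 2], 2,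
     ![![1, 0, 2, 4, 3, 6, 5, 8, 7],
       ![1, 0, 2, 4, 3, 7, 8, 5, 6],
       ![0, 2, 3, 1, 5, 4, 7, 6, 8],
       ![0, 3, 1, 2, 5, 8, 6, 7, 4]]⟩,
   ⟨8, ![0, 1, 0, 2], ![0, 1, 0, 2], 8,
     ![![1, 0, 3, 2, 6, 7, 4, 5, 8],
       ![1, 0, 2, 4, 5, 3, 7, 6, 8],
       ![0, 2, 1, 5, 7, 3, 8, 4, 6],
       ![0, 2, 3, 1, 4, 8, 5, 7, 6]]⟩,
   ⟨4, ![0, 1, 1, 1], ![0, 1, 1, 1], 3,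
     ![![1, 0, 4, 3, 2],
       ![1, 2, 0, 3, 4],
       ![0, 3, 2, 4, 1],
       ![0, 2, 3, 1, 4]]⟩]

theorem annularTables_valid : ∀ t ∈ annularTables, t.Valid := by
  decide +kernel

/-- The pairs `(k, m)` of numbers of fixed points and three-cycles. -/
abbrev Profile : Type := (Fin 4 → ℕ) × (Fin 4 → ℕ)

namespace Profile

/-- A profile realized by annular data. -/
def IsAnnular (v : Profile) : Prop := ∃ n, Annular v.1 v.2 n

theorem IsAnnular.add {v w : Profile} : v.IsAnnular → w.IsAnnular → (v + w).IsAnnular :=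
  fun ⟨_, hv⟩ ⟨_, hw⟩ => ⟨_, hv.add hw⟩

/-- The permutations of the branch points preserving the partition `{{0, 1}, {2, 3}}`. -/
def dihedral : List (Perm (Fin 4)) :=
  let a := swap 0 1
  let b := Equiv.addRight 2
  [1, a, b, a * b, b * a, a * b * a, b * a * b, a * b * a * b]

theorem IsAnnular.comp {v : Profile} (h : v.IsAnnular) {π : Perm (Fin 4)} (hπ : π ∈ dihedral) :
    IsAnnular (v.1 ∘ π, v.2 ∘ π) := by
  let P (π : Perm (Fin 4)) : Prop := ∀ v : Profile, v.IsAnnular → IsAnnular (v.1 ∘ π, v.2 ∘ π)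
  have hone : P 1 := fun _ h => h
  have hmul : ∀ {π ρ}, P π → P ρ → P (π * ρ) := fun hπ hρ v h => hρ _ (hπ v h)
  have ha : P (swap 0 1) := fun _ ⟨_, h⟩ => ⟨_, h.swap_zero_one⟩
  have hb : P (Equiv.addRight 2) := fun _ ⟨_, h⟩ => ⟨_, h.swap_pairs⟩
  suffices ∀ π ∈ dihedral, P π from this π hπ v h
  simp only [dihedral, List.forall_mem_cons, List.not_mem_nil, IsEmpty.forall_iff, implies_true,
    and_true]
  exact ⟨hone, ha, hb, hmul ha hb, hmul hb ha, hmul (hmul ha hb) ha, hmul (hmul hb ha) hb,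
    hmul (hmul (hmul ha hb) ha) hb⟩

/-- A profile that is tabulated up to symmetry. -/
def Tabulated (v : Profile) : Prop :=
  ∃ t ∈ annularTables, ∃ π ∈ dihedral, v = (t.ones ∘ π, t.threes ∘ π)

instance : DecidablePred Tabulated := fun v => by unfold Tabulated; infer_instance

theorem Tabulated.isAnnular {v : Profile} : v.Tabulated → v.IsAnnular := by
  rintro ⟨t, ht, π, hπ, rfl⟩
  exact IsAnnular.comp (v := (t.ones, t.threes)) ⟨_, (annularTables_valid t ht).annular⟩ hπ

/-- The exceptional profile with one fixed point and one three-cycle over the same point. -/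
def unit (i : Fin 4) : Profile := (Pi.single i 1, Pi.single i 1)

/-- The profile with two fixed points over `i` and two three-cycles over `j`. -/
def double (i j : Fin 4) : Profile := (Pi.single i 2, Pi.single j 2)

/-- The minimal profiles compatible with odd degree. -/
def oddProfiles : List Profile :=
  [(![1, 1, 0, 0], ![0, 0, 1, 1]), (![1, 0, 1, 0], ![0, 1, 0, 1]),
   (![1, 0, 0, 1], ![0, 1, 1, 0]), (![0, 1, 1, 0], ![1, 0, 0, 1]),
   (![0, 1, 0, 1], ![1, 0, 1, 0]), (![0, 0, 1, 1], ![1, 1, 0, 0]),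
   (![3, 0, 0, 0], ![0, 1, 1, 1]), (![0, 1, 1, 1], ![3, 0, 0, 0]),
   (![0, 3, 0, 0], ![1, 0, 1, 1]), (![1, 0, 1, 1], ![0, 3, 0, 0]),
   (![0, 0, 3, 0], ![1, 1, 0, 1]), (![1, 1, 0, 1], ![0, 0, 3, 0]),
   (![0, 0, 0, 3], ![1, 1, 1, 0]), (![1, 1, 1, 0], ![0, 0, 0, 3])]

theorem isAnnular_unit_add_unit (i j : Fin 4) : (unit i + unit j).IsAnnular :=
  Tabulated.isAnnular (by revert i j; decide +kernel)

theorem isAnnular_unit_add_unit_add_unit (i j l : Fin 4) :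
    (unit i + unit j + unit l).IsAnnular :=
  Tabulated.isAnnular (by revert i j l; decide +kernel)

theorem isAnnular_double {i j : Fin 4} (h : i ≠ j) : (double i j).IsAnnular :=
  Tabulated.isAnnular (by revert i j; decide +kernel)

theorem isAnnular_double_add_unit {i j : Fin 4} (h : i ≠ j) (l : Fin 4) :
    (double i j + unit l).IsAnnular :=
  Tabulated.isAnnular (by revert i j l; decide +kernel)

theorem isAnnular_odd {v : Profile} (h : v ∈ oddProfiles) : v.IsAnnular :=
  Tabulated.isAnnular (by revert v; decide +kernel)

theorem isAnnular_odd_add_unit {v : Profile} (h : v ∈ oddProfiles) (i : Fin 4) :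
    (v + unit i).IsAnnular :=
  Tabulated.isAnnular (by revert v; revert i; decide +kernel)

/-- `v` is zero or exceptional, or both `v` and all its sums with exceptional profiles are
annular. -/
def Stable (v : Profile) : Prop :=
  v = 0 ∨ (∃ i, v = unit i) ∨ v.IsAnnular ∧ ∀ i, (v + unit i).IsAnnular

theorem Stable.add_unit {v : Profile} (h : v.Stable) (i : Fin 4) : (v + unit i).Stable := by
  rcases h with rfl | ⟨l, rfl⟩ | ⟨h, h'⟩
  · exact .inr (.inl ⟨i, zero_add _⟩)
  · exact .inr (.inr ⟨isAnnular_unit_add_unit _ _, isAnnular_unit_add_unit_add_unit _ _⟩)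
  · exact .inr (.inr ⟨h' i, fun j => add_assoc v _ _ ▸ h.add (isAnnular_unit_add_unit _ _)⟩)

theorem Stable.add_double {v : Profile} (h : v.Stable) {i j : Fin 4} (hij : i ≠ j) :
    (v + double i j).Stable := by
  have hd := isAnnular_double hij
  have hdu := isAnnular_double_add_unit hij
  refine .inr (.inr ?_)
  rcases h with rfl | ⟨l, rfl⟩ | ⟨h, h'⟩
  · rw [zero_add]
    exact ⟨hd, hdu⟩
  · rw [add_comm]
    exact ⟨hdu l, fun i => add_assoc (double _ _) _ _ ▸ hd.add (isAnnular_unit_add_unit _ _)⟩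
  · exact ⟨h.add hd, fun l => add_assoc v _ _ ▸ h.add (hdu l)⟩

/-- The necessary conditions on a profile: genus one, and a degree parity common to all branch
points. -/
def Admissible (v : Profile) : Prop :=
  ∑ i, v.1 i = ∑ i, v.2 i ∧ ∀ i j, v.1 i + v.2 i ≡ v.1 j + v.2 j [MOD 2]

theorem mem_oddProfiles_of_table (c : Fin 4 → Fin 4) :
    let k : Fin 4 → ℕ := fun i => ![0, 0, 1, 3] (c i)
    let m : Fin 4 → ℕ := fun i => ![1, 3, 0, 0] (c i)
    ∑ i, k i = ∑ i, m i → (∀ i j, i ≠ j → 2 ≤ k i → m j < 2) → (k, m) ∈ oddProfiles := by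
  revert c
  decide +kernel

theorem Admissible.cases {v : Profile} (h : v.Admissible) :
    v = 0 ∨ v ∈ oddProfiles ∨ (∃ i, 1 ≤ v.1 i ∧ 1 ≤ v.2 i) ∨
      ∃ i j, i ≠ j ∧ 2 ≤ v.1 i ∧ 2 ≤ v.2 j := by
  obtain ⟨k, m⟩ := v
  obtain ⟨hsum, hmod⟩ := h
  by_cases hu : ∃ i, 1 ≤ k i ∧ 1 ≤ m i
  · exact .inr (.inr (.inl hu))
  by_cases hd : ∃ i j, i ≠ j ∧ 2 ≤ k i ∧ 2 ≤ m j
  · exact .inr (.inr (.inr hd))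
  push Not at hu hd
  simp only [Nat.ModEq] at hsum hmod
  have hk : ∀ i, k i = 0 ∨ m i = 0 := fun i => by have := hu i; omega
  have hsum3 : ∀ f : Fin 4 → ℕ, ∀ i, f i = 0 → (∀ j, i ≠ j → f j < 2) → ∑ j, f j ≤ 3 := by
    intro f i hi hf
    rw [← add_sum_erase _ _ (mem_univ i), hi, zero_add]
    calc ∑ j ∈ univ.erase i, f j ≤ #(univ.erase i) • 1 :=
          sum_le_card_nsmul _ _ _ fun j hj => Nat.le_of_lt_succ (hf j (ne_of_mem_erase hj).symm)
      _ = 3 := by simp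
  have hle : ∀ f : Fin 4 → ℕ, ∀ i, f i ≤ ∑ j, f j := fun f i =>
    single_le_sum (fun _ _ => Nat.zero_le _) (mem_univ i)
  rcases Nat.mod_two_eq_zero_or_one (k 0 + m 0) with h0 | h0
  · left
    have hk0 : ∀ i, k i = 0 := by
      intro i
      by_contra hki
      have hmi : ∀ j, m j = 0 := by
        intro j
        by_cases hij : i = j
        · subst hij
          exact (hk i).resolve_left hki
        · have := hd i j hij
          have := hmod 0 i
          have := hmod 0 j
          have := hk i
          have := hk j
          omega
      have := hle k i
      simp only [hsum, hmi, sum_const_zero] at this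
      omega
    have hm0 : ∀ i, m i = 0 := fun i => by
      have := hle m i
      simp only [← hsum, hk0, sum_const_zero] at this
      omega
    exact Prod.ext (funext hk0) (funext hm0)
  · right; left
    have hc : ∀ i, ∃ c : Fin 4, k i = (![0, 0, 1, 3] : Fin 4 → ℕ) c ∧
        m i = (![1, 3, 0, 0] : Fin 4 → ℕ) c := by
      intro i
      have hk3 : k i ≤ 3 := by
        by_contra hki
        have := hsum3 m i ((hk i).resolve_left (by omega)) fun j hij => hd i j hij (by omega)
        have := hle k i
        omega
      have hm3 : m i ≤ 3 := by
        by_contra hmi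
        have := hsum3 k i ((hk i).resolve_right (by omega)) fun j hij => by
          have := hd j i hij.symm
          omega
        have := hle m i
        omega
      have := hmod 0 i
      have : k i = 0 ∧ m i = 1 ∨ k i = 0 ∧ m i = 3 ∨ k i = 1 ∧ m i = 0 ∨ k i = 3 ∧ m i = 0 := by
        have := hk i
        omega
      rcases this with h | h | h | h
      exacts [⟨0, h⟩, ⟨1, h⟩, ⟨2, h⟩, ⟨3, h⟩]
    choose c hck hcm using hc
    obtain rfl : k = fun i => ![0, 0, 1, 3] (c i) := funext hck
    obtain rfl : m = fun i => ![1, 3, 0, 0] (c i) := funext hcm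
    exact mem_oddProfiles_of_table c hsum hd

theorem Admissible.of_add {v w : Profile} (h : (v + w).Admissible)
    (hw : w.Admissible) : v.Admissible := by
  obtain ⟨h1, h2⟩ := h
  obtain ⟨h1', h2'⟩ := hw
  simp only [Prod.fst_add, Prod.snd_add, Pi.add_apply, sum_add_distrib, Nat.ModEq] at h1 h2 h2'
  refine ⟨by omega, fun i j => ?_⟩
  have := h2 i j
  have := h2' i j
  simp only [Nat.ModEq]
  omega

theorem admissible_unit (i : Fin 4) : (unit i).Admissible := by
  unfold Admissible
  revert i
  decide

theorem admissible_double (i j : Fin 4) : (double i j).Admissible := by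
  unfold Admissible
  revert i j
  decide

theorem Admissible.stable {v : Profile} (h : v.Admissible) : v.Stable := by
  induction hn : ∑ i, v.1 i using Nat.strong_induction_on generalizing v with
  | _ n ih =>
    have hsub : ∀ {w : Profile}, w.Admissible → 0 < ∑ i, w.1 i → w ≤ v → (v - w).Stable := by
      intro w hw hpos hle
      rw [← tsub_add_cancel_of_le hle] at h hn
      refine ih _ ?_ (h.of_add hw) rfl
      rw [← hn]
      simp only [Prod.fst_add, Pi.add_apply, sum_add_distrib]
      omega
    have single_le : ∀ {f : Fin 4 → ℕ} {i a}, a ≤ f i → Pi.single i a ≤ f := by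
      intro f i a ha j
      rcases eq_or_ne j i with rfl | hj
      · simpa using ha
      · simp [hj]
    rcases h.cases with rfl | ho | ⟨i, hk, hm⟩ | ⟨i, j, hij, hk, hm⟩
    · exact .inl rfl
    · exact .inr (.inr ⟨isAnnular_odd ho, isAnnular_odd_add_unit ho⟩)
    · have hle : unit i ≤ v := ⟨single_le hk, single_le hm⟩
      rw [← tsub_add_cancel_of_le hle]
      exact (hsub (admissible_unit i) (by simp [unit]) hle).add_unit i
    · have hle : double i j ≤ v := ⟨single_le hk, single_le hm⟩
      rw [← tsub_add_cancel_of_le hle]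
      exact (hsub (admissible_double i j) (by simp [double]) hle).add_double hij

end Profile

theorem annular_zero : Annular 0 0 2 := by
  have h0 : (0 : Fin 4 → ℕ) = ![0, 0, 0, 0] := by decide
  rw [h0]
  exact (annularTables_valid _ List.mem_cons_self).annular

theorem Annular.add_two_mul {k m : Fin 4 → ℕ} {n : ℕ} (h : Annular k m n) (j : ℕ) :
    Annular k m (n + 2 * j) := by
  induction j with
  | zero => exact h
  | succ j ih => simpa [mul_add, add_assoc] using ih.add annular_zero

theorem Annular.eventually_realizable {k m : Fin 4 → ℕ} {n₀ : ℕ} (h : Annular k m n₀) {n : ℕ}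
    (hn : n₀ ≤ n) (hd : k 0 + 3 * m 0 ≤ n ∧ 2 ∣ n - (k 0 + 3 * m 0)) :
    Realizable n (List.ofFn fun i =>
      Multiset.replicate (k i) 1 + Multiset.replicate (m i) 3 +
        Multiset.replicate ((n - (k i + 3 * m i)) / 2) 2) := by
  have h' := h
  obtain ⟨_, _, _, _, _, _, b, _, _, _, _, _, _, _, hb, -⟩ := h'
  have h0 := (hb 0).2
  obtain ⟨j, rfl⟩ : ∃ j, n = n₀ + 2 * j := ⟨(n - n₀) / 2, by omega⟩
  exact annular_realizable (h.add_two_mul j)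

/-- Theorem 1.3: every family of almost-regular genus-1 ramification data of the form
[1^{k_1},3^{m_1},2^*][1^{k_2},3^{m_2},2^*][1^{k_3},3^{m_3},2^*][1^{k_4},3^{m_4},2^*]
(the genus-1 condition being Σ k_i = Σ m_i), except the exceptional type
[1,3,2^*][2^*][2^*][2^*], is realizable in all sufficiently large compatible degrees. -/
theorem stmt1 (k m : Fin 4 → ℕ)
    (hsum : ∑ i, k i = ∑ i, m i)
    (hexc : ¬ ∃ i, k i = 1 ∧ m i = 1 ∧ ∀ j, j ≠ i → k j = 0 ∧ m j = 0) :
    ∃ N, ∀ n ≥ N,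
      (∀ i, k i + 3 * m i ≤ n ∧ 2 ∣ (n - (k i + 3 * m i))) →
      Realizable n (List.ofFn fun i =>
        Multiset.replicate (k i) 1 + Multiset.replicate (m i) 3 +
          Multiset.replicate ((n - (k i + 3 * m i)) / 2) 2) := by
  by_cases hmod : ∀ i j, k i + m i ≡ k j + m j [MOD 2]
  · rcases Profile.Admissible.stable (v := (k, m)) ⟨hsum, hmod⟩ with h | ⟨i, hi⟩ | ⟨h, -⟩
    · obtain ⟨rfl, rfl⟩ := Prod.mk_eq_zero.1 h
      exact ⟨2, fun n hn hd => annular_zero.eventually_realizable hn (hd 0)⟩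
    · obtain ⟨rfl, rfl⟩ := Prod.mk.inj hi
      exact absurd ⟨i, by simp, by simp, fun j hj => by simp [hj]⟩ hexc
    · obtain ⟨n₀, hA⟩ := h
      exact ⟨n₀, fun n hn hd => hA.eventually_realizable hn (hd 0)⟩
  · refine ⟨0, fun n _ hd => absurd (fun i j => ?_) hmod⟩
    have hi := hd i
    have hj := hd j
    simp only [Nat.ModEq]
    omega
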